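/- arXiv:2505.18256 — 6 statements merged into one kernel-verified Lean document; each statement's English description precedes it below -/
import Mathlib

section
/- Let m be a finite type, n a natural number, u : Fin n → Matrix m m ℂ a sequence of square complex matrices, and S a set of indices such that the ordered product of u j over j ∈ S (in increasing order of j) equals the identity matrix 1. Then ctrl(the ordered product of u over all of Fin n) equals the ordered product over all j : Fin n of the matrices (free(u j) if j ∈ S, and ctrl(u j) otherwise). -/
/-- The controlled matrix: apply `U` on the second block, identity on the first. -/
def ctrl {m : Type*} [DecidableEq m] (U : Matrix m m ℂ) : Matrix (m ⊕ m) (m ⊕ m) ℂ :=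
  Matrix.fromBlocks 1 0 0 U

/-- The free (uncontrolled) matrix: apply `U` on both blocks. -/
def free {m : Type*} (U : Matrix m m ℂ) : Matrix (m ⊕ m) (m ⊕ m) ℂ :=
  Matrix.fromBlocks U 0 0 U

/-- An ordered product of free and controlled matrices is block diagonal: the first block collects
the free factors only, the second block collects all factors. -/
theorem prod_map_ite_free_ctrl {m ι : Type*} [Fintype m] [DecidableEq m]
    (u : ι → Matrix m m ℂ) (p : ι → Prop) [DecidablePred p] (l : List ι) :
    (l.map fun j => if p j then free (u j) else ctrl (u j)).prod =
      Matrix.fromBlocks ((l.filter fun j => decide (p j)).map u).prod 0 0 (l.map u).prod := by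
  induction l with
  | nil => simp
  | cons a l ih =>
    rw [List.map_cons, List.prod_cons, ih]
    by_cases h : p a <;> simp [h, free, ctrl, Matrix.fromBlocks_multiply]

/-- If the ordered product of the operations with indices in `S` is the identity, then the
control of these operations can be skipped when controlling the whole product. -/
theorem ctrl_ordered_prod_skip {m : Type*} [Fintype m] [DecidableEq m] (n : ℕ)
    (u : Fin n → Matrix m m ℂ) (S : Set (Fin n)) [DecidablePred (· ∈ S)]
    (hS : (((List.finRange n).filter fun j => decide (j ∈ S)).map u).prod = 1) :
    ctrl ((List.finRange n).map u).prod =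
      ((List.finRange n).map fun j => if j ∈ S then free (u j) else ctrl (u j)).prod := by
  rw [prod_map_ite_free_ctrl u (· ∈ S), hS, ctrl]
end

section
/- Let m be a finite type and let A, B : Matrix m m ℂ be invertible square complex matrices. Then ctrl(A * B * A⁻¹ * B⁻¹) = free(A) * free(B) * free(A⁻¹) * free(B⁻¹) if and only if A * B = B * A. (That is, for two interlaced conjugation pairs, skipping the control of all four operations is valid if and only if the pair operations commute.) -/
theorem free_mul {m : Type*} [Fintype m] (U V : Matrix m m ℂ) :
    free U * free V = free (U * V) := by
  simp [free, Matrix.fromBlocks_multiply]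

theorem ctrl_eq_free_iff {m : Type*} [DecidableEq m] (U : Matrix m m ℂ) :
    ctrl U = free U ↔ U = 1 := by
  simp [ctrl, free, Matrix.fromBlocks_inj, eq_comm]

theorem mul_mul_inv_mul_inv_eq_one_iff {m : Type*} [Fintype m] [DecidableEq m]
    {A B : Matrix m m ℂ} (hA : IsUnit A) (hB : IsUnit B) :
    A * B * A⁻¹ * B⁻¹ = 1 ↔ A * B = B * A := by
  obtain ⟨a, rfl⟩ := hA
  obtain ⟨b, rfl⟩ := hB
  rw [← Matrix.coe_units_inv, ← Matrix.coe_units_inv, Units.mul_inv_eq_one,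
    Units.mul_inv_eq_iff_eq_mul]

/-- For two interlaced conjugation pairs `A, A⁻¹` and `B, B⁻¹`, skipping the control of all
four operations is valid if and only if `A` and `B` commute. -/
theorem ctrl_interlaced_skip_iff_commute {m : Type*} [Fintype m] [DecidableEq m]
    (A B : Matrix m m ℂ) (hA : IsUnit A) (hB : IsUnit B) :
    ctrl (A * B * A⁻¹ * B⁻¹) = free A * free B * free A⁻¹ * free B⁻¹ ↔ A * B = B * A := by
  rw [free_mul, free_mul, free_mul, ctrl_eq_free_iff, mul_mul_inv_mul_inv_eq_one_iff hA hB]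
end

section
/- Let G be a group, u : ℕ → G, and let P be a finite set of index pairs (a, b) such that for every (a, b) ∈ P one has a < b and u b = (u a)⁻¹, all indices appearing as endpoints of pairs in P are pairwise distinct, and no two distinct pairs in P interlace. Then the product of u k over all indices k that are an endpoint of some pair in P, taken in increasing order of k, equals 1. -/
/-- Two index pairs `(i₁, j₁)` and `(i₂, j₂)` (each with first component smaller) interlace if
`i₁ < i₂ < j₁ < j₂` or `i₂ < i₁ < j₂ < j₁`. -/
def Interlace (p q : ℕ × ℕ) : Prop :=
  (p.1 < q.1 ∧ q.1 < p.2 ∧ p.2 < q.2) ∨ (q.1 < p.1 ∧ p.1 < q.2 ∧ q.2 < p.2)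

theorem Finset.sort_union_of_forall_lt {α : Type*} [LinearOrder α] {A B : Finset α}
    (h : ∀ x ∈ A, ∀ y ∈ B, x < y) :
    (A ∪ B).sort (· ≤ ·) = A.sort (· ≤ ·) ++ B.sort (· ≤ ·) := by
  have hn : (A.sort (· ≤ ·) ++ B.sort (· ≤ ·)).Nodup := by
    refine List.nodup_append.2 ⟨A.sort_nodup _, B.sort_nodup _, fun x hx y hy => ?_⟩
    exact (h x ((A.mem_sort _).1 hx) y ((B.mem_sort _).1 hy)).ne
  have hs : (A.sort (· ≤ ·) ++ B.sort (· ≤ ·)).Pairwise (· ≤ ·) := by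
    refine List.pairwise_append.2 ⟨A.pairwise_sort _, B.pairwise_sort _, fun x hx y hy => ?_⟩
    exact (h x ((A.mem_sort _).1 hx) y ((B.mem_sort _).1 hy)).le
  rw [← (List.toFinset_sort (· ≤ ·) hn).2 hs]
  simp

/-- For a non-crossing set of conjugation pairs with pairwise distinct endpoints, the ordered
product of the paired operations is the identity. -/
theorem prod_conj_pairs_noncrossing {G : Type*} [Group G] (u : ℕ → G)
    (P : Finset (ℕ × ℕ))
    (hpair : ∀ p ∈ P, p.1 < p.2 ∧ u p.2 = (u p.1)⁻¹)
    (hdisj : ∀ p ∈ P, ∀ q ∈ P, p ≠ q →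
      p.1 ≠ q.1 ∧ p.1 ≠ q.2 ∧ p.2 ≠ q.1 ∧ p.2 ≠ q.2)
    (hcross : ∀ p ∈ P, ∀ q ∈ P, p ≠ q → ¬ Interlace p q) :
    (((P.biUnion fun p => {p.1, p.2}).sort (· ≤ ·)).map u).prod = 1 := by
  induction hn : P.card generalizing P with
  | zero => simp [Finset.card_eq_zero.1 hn]
  | succ n ih =>
    obtain ⟨p, hp, hmin⟩ := P.exists_min_image (fun p => p.2 - p.1)
      (Finset.card_pos.1 (by omega))
    have hlt := (hpair p hp).1
    have hout : ∀ q ∈ P.erase p, ∀ k, k = q.1 ∨ k = q.2 → k < p.1 ∨ p.2 < k := by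
      intro q hq k hk
      have hqP := Finset.mem_of_mem_erase hq
      have hne := (Finset.ne_of_mem_erase hq).symm
      have hd := hdisj p hp q hqP hne
      have hc := hcross p hp q hqP hne
      have hm := hmin q hqP
      have hq' := (hpair q hqP).1
      simp only [Interlace] at hc
      omega
    have hrec := ih (P.erase p)
      (fun q hq => hpair q (Finset.mem_of_mem_erase hq))
      (fun q hq r hr => hdisj q (Finset.mem_of_mem_erase hq) r (Finset.mem_of_mem_erase hr))
      (fun q hq r hr => hcross q (Finset.mem_of_mem_erase hq) r (Finset.mem_of_mem_erase hr))
      (by rw [Finset.card_erase_of_mem hp, hn, Nat.add_sub_cancel])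
    set E := (P.erase p).biUnion fun p => ({p.1, p.2} : Finset ℕ) with hE
    have hEout : ∀ k ∈ E, k < p.1 ∨ p.2 < k := by
      intro k hk
      obtain ⟨q, hq, hkq⟩ := Finset.mem_biUnion.1 hk
      exact hout q hq k (by simpa using hkq)
    have hsplit : E = E.filter (· < p.1) ∪ E.filter (p.2 < ·) := by
      rw [← Finset.filter_or, Finset.filter_true_of_mem hEout]
    have hP : (P.biUnion fun p => ({p.1, p.2} : Finset ℕ)) =
        E.filter (· < p.1) ∪ (({p.1} ∪ {p.2}) ∪ E.filter (p.2 < ·)) := by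
      rw [← Finset.insert_erase hp, Finset.biUnion_insert, ← hE]
      conv_lhs => rw [hsplit]
      ext k
      simp only [Finset.mem_union, Finset.mem_insert, Finset.mem_singleton]
      tauto
    rw [hsplit, Finset.sort_union_of_forall_lt (by simp only [Finset.mem_filter]; omega),
      List.map_append, List.prod_append] at hrec
    rw [hP, Finset.sort_union_of_forall_lt
        (by simp only [Finset.mem_union, Finset.mem_singleton, Finset.mem_filter]; omega),
      Finset.sort_union_of_forall_lt
        (by simp only [Finset.mem_union, Finset.mem_singleton, Finset.mem_filter]; omega),
      Finset.sort_union_of_forall_lt (by simpa using hlt)]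
    simpa [(hpair p hp).2] using hrec
end

section
/- Let G be a group, u : ℕ → G, and let P be a finite set of index pairs (a, b) such that for every (a, b) ∈ P one has a < b and u b = (u a)⁻¹, all indices appearing as endpoints of pairs in P are pairwise distinct, and for any two distinct pairs (a₁, b₁), (a₂, b₂) ∈ P, either the pairs do not interlace or the group elements u a₁ and u a₂ commute. Then the product of u k over all indices k that are an endpoint of some pair in P, taken in increasing order of k, equals 1. -/
theorem Finset.sort_eq_of_pairwise_lt {α : Type*} [LinearOrder α] {s : Finset α} {l : List α}
    (hl : l.Pairwise (· < ·))
    (hs : ∀ x, x ∈ s ↔ x ∈ l) : s.sort (· ≤ ·) = l := by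
  have hset : s = l.toFinset := by ext x; simp [hs]
  rw [hset, List.toFinset_sort _ (hl.imp ne_of_lt)]
  exact hl.imp le_of_lt

/-- Inserting two mutually inverse factors into an ordered product does not change it if the first
commutes with all factors between them. -/
theorem prod_sort_insert_insert {G : Type*} [Group G] (u : ℕ → G) (s : Finset ℕ) {a b : ℕ}
    (hab : a < b) (ha : a ∉ s) (hb : b ∉ s) (hu : u b = (u a)⁻¹)
    (hcomm : ∀ k ∈ s, a < k → k < b → Commute (u a) (u k)) :
    (((insert a (insert b s)).sort (· ≤ ·)).map u).prod = ((s.sort (· ≤ ·)).map u).prod := by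
  have hsort (t : Finset ℕ) : (t.sort (· ≤ ·)).Pairwise (· < ·) := t.sortedLT_sort.pairwise
  have hne : ∀ x ∈ s, x ≠ a ∧ x ≠ b := fun x hx =>
    ⟨fun h => ha (h ▸ hx), fun h => hb (h ▸ hx)⟩
  set l₁ := (s.filter (· < a)).sort (· ≤ ·) with h₁
  set l₂ := (s.filter fun k => a < k ∧ k < b).sort (· ≤ ·) with h₂
  set l₃ := (s.filter (b < ·)).sort (· ≤ ·) with h₃
  have m₁ (x : ℕ) : x ∈ l₁ ↔ x ∈ s ∧ x < a := by simp [h₁]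
  have m₂ (x : ℕ) : x ∈ l₂ ↔ x ∈ s ∧ a < x ∧ x < b := by simp [h₂]
  have m₃ (x : ℕ) : x ∈ l₃ ↔ x ∈ s ∧ b < x := by simp [h₃]
  have e : s.sort (· ≤ ·) = l₁ ++ (l₂ ++ l₃) := by
    apply Finset.sort_eq_of_pairwise_lt
    · simp only [List.pairwise_append, List.mem_append]
      exact ⟨hsort _, ⟨hsort _, hsort _, by grind⟩, by grind⟩
    · intro x
      simp only [List.mem_append, m₁, m₂, m₃]
      have := hne x
      grind
  have e' : (insert a (insert b s)).sort (· ≤ ·) = l₁ ++ (a :: (l₂ ++ (b :: l₃))) := by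
    apply Finset.sort_eq_of_pairwise_lt
    · simp only [List.pairwise_append, List.pairwise_cons, List.mem_append, List.mem_cons]
      exact ⟨hsort _, ⟨by grind, hsort _, ⟨by grind, hsort _⟩, by grind⟩, by grind⟩
    · intro x
      simp only [List.mem_append, List.mem_cons, Finset.mem_insert, m₁, m₂, m₃]
      have := hne x
      grind
  have hc : Commute (u a) (l₂.map u).prod := by
    apply Commute.list_prod_right
    intro x hx
    obtain ⟨k, hk, rfl⟩ := List.mem_map.1 hx
    obtain ⟨hks, hak, hkb⟩ := (m₂ k).1 hk
    exact hcomm k hks hak hkb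
  rw [e, e']
  simp only [List.map_append, List.map_cons, List.prod_append, List.prod_cons, hu]
  rw [← mul_assoc (u a), hc.eq]
  group

/-- For a set of conjugation pairs with pairwise distinct endpoints such that any two distinct
pairs either do not interlace or have commuting operations, the ordered product of the paired
operations is the identity. -/
theorem prod_conj_pairs_commute_or_noncrossing {G : Type*} [Group G] (u : ℕ → G)
    (P : Finset (ℕ × ℕ))
    (hpair : ∀ p ∈ P, p.1 < p.2 ∧ u p.2 = (u p.1)⁻¹)
    (hdisj : ∀ p ∈ P, ∀ q ∈ P, p ≠ q →
      p.1 ≠ q.1 ∧ p.1 ≠ q.2 ∧ p.2 ≠ q.1 ∧ p.2 ≠ q.2)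
    (hcross : ∀ p ∈ P, ∀ q ∈ P, p ≠ q → ¬ Interlace p q ∨ Commute (u p.1) (u q.1)) :
    (((P.biUnion fun p => {p.1, p.2}).sort (· ≤ ·)).map u).prod = 1 := by
  induction hn : P.card generalizing P with
  | zero => simp [Finset.card_eq_zero.1 hn]
  | succ n ih =>
    obtain ⟨p, hp, hmin⟩ := P.exists_min_image (fun p => p.2 - p.1)
      (Finset.card_pos.1 (by omega))
    have hP : (P.biUnion fun p => ({p.1, p.2} : Finset ℕ)) =
        insert p.1 (insert p.2 ((P.erase p).biUnion fun p => {p.1, p.2})) := by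
      conv_lhs => rw [← Finset.insert_erase hp, Finset.biUnion_insert]
      simp
    have hmem (k : ℕ) (hk : k ∈ (P.erase p).biUnion fun p => ({p.1, p.2} : Finset ℕ)) :
        ∃ q ∈ P, p ≠ q ∧ (k = q.1 ∨ k = q.2) := by
      obtain ⟨q, hq, hkq⟩ := Finset.mem_biUnion.1 hk
      rw [Finset.mem_erase] at hq
      exact ⟨q, hq.2, hq.1.symm, by simpa using hkq⟩
    rw [hP, prod_sort_insert_insert u _ (hpair p hp).1 _ _ (hpair p hp).2]
    · apply ih
      · exact fun q hq => hpair q (Finset.mem_of_mem_erase hq)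
      · exact fun q hq r hr => hdisj q (Finset.mem_of_mem_erase hq) r (Finset.mem_of_mem_erase hr)
      · exact fun q hq r hr => hcross q (Finset.mem_of_mem_erase hq) r (Finset.mem_of_mem_erase hr)
      · rw [Finset.card_erase_of_mem hp]
        omega
    · intro k hk hpk hkp
      obtain ⟨q, hq, hne, hkq⟩ := hmem k hk
      have hpq := hdisj p hp q hq hne
      have hlt := hpair q hq
      have hle := hmin q hq
      have hcomm : Commute (u p.1) (u q.1) := by
        refine (hcross p hp q hq hne).resolve_left (not_not.2 ?_)
        unfold Interlace
        omega
      rcases hkq with rfl | rfl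
      · exact hcomm
      · rw [hlt.2]
        exact hcomm.inv_right
    · intro hk
      obtain ⟨q, hq, hne, hkq⟩ := hmem _ hk
      have := hdisj p hp q hq hne
      omega
    · intro hk
      obtain ⟨q, hq, hne, hkq⟩ := hmem _ hk
      have := hdisj p hp q hq hne
      omega
end

section
/- Let G be a simple graph on Fin n with decidable adjacency. Then for all vertices i, j : Fin n, the matrices g_i and g_j commute if and only if i and j are not adjacent in G. -/
/-- The tensor-product matrix of a family of 2×2 matrices indexed by `ι`. -/
def tensorProd {ι : Type*} [Fintype ι] (A : ι → Matrix (Fin 2) (Fin 2) ℂ) :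
    Matrix (ι → Fin 2) (ι → Fin 2) ℂ :=
  Matrix.of fun f g => ∏ e : ι, (A e) (f e) (g e)

/-- The Pauli X matrix. -/
def pauliX : Matrix (Fin 2) (Fin 2) ℂ := !![0, 1; 1, 0]

/-- The Pauli Z matrix. -/
def pauliZ : Matrix (Fin 2) (Fin 2) ℂ := !![1, 0; 0, -1]

/-- For a vertex `i`, the family assigning to edge `e` the matrix `X` if `i` is the smaller
endpoint of `e`, `Z` if `i` is the larger endpoint of `e`, and `1` otherwise. -/
def pauliFamily {n : ℕ} (G : SimpleGraph (Fin n)) [DecidableRel G.Adj] (i : Fin n)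
    (e : G.edgeFinset) : Matrix (Fin 2) (Fin 2) ℂ :=
  if i = Sym2.inf (e : Sym2 (Fin n)) then pauliX
  else if i = Sym2.sup (e : Sym2 (Fin n)) then pauliZ
  else 1

/-- The operator `g_i` associated to vertex `i`: the tensor product over all edges of the
Pauli family of `i`. -/
def gMat {n : ℕ} (G : SimpleGraph (Fin n)) [DecidableRel G.Adj] (i : Fin n) :
    Matrix (G.edgeFinset → Fin 2) (G.edgeFinset → Fin 2) ℂ :=
  tensorProd (pauliFamily G i)

theorem tensorProd_mul {ι : Type*} [Fintype ι] [DecidableEq ι]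
    (A B : ι → Matrix (Fin 2) (Fin 2) ℂ) :
    tensorProd A * tensorProd B = tensorProd fun e => A e * B e := by
  ext f g
  simp only [tensorProd, Matrix.mul_apply, Matrix.of_apply, Finset.prod_univ_sum,
    Fintype.piFinset_univ, Finset.prod_mul_distrib]

theorem tensorProd_smul {ι : Type*} [Fintype ι] (c : ι → ℂ)
    (A : ι → Matrix (Fin 2) (Fin 2) ℂ) :
    (tensorProd fun e => c e • A e) = (∏ e, c e) • tensorProd A := by
  ext f g
  simp [tensorProd, Finset.prod_mul_distrib]

theorem tensorProd_one {ι : Type*} [Fintype ι] [DecidableEq ι] :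
    (tensorProd fun _ : ι => 1) = 1 := by
  ext f g
  by_cases h : f = g
  · subst h
    simp [tensorProd]
  · obtain ⟨e, he⟩ := Function.ne_iff.mp h
    rw [Matrix.one_apply_ne h]
    exact Finset.prod_eq_zero (Finset.mem_univ e) (Matrix.one_apply_ne he)

theorem pauliX_mul_self : pauliX * pauliX = 1 := by
  simp [pauliX, Matrix.one_fin_two]

theorem pauliZ_mul_self : pauliZ * pauliZ = 1 := by
  simp [pauliZ, Matrix.one_fin_two]

theorem pauliX_mul_pauliZ : pauliX * pauliZ = -(pauliZ * pauliX) := by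
  simp [pauliX, pauliZ]

theorem pauliFamily_mul_self {n : ℕ} (G : SimpleGraph (Fin n)) [DecidableRel G.Adj]
    (i : Fin n) (e : G.edgeFinset) : pauliFamily G i e * pauliFamily G i e = 1 := by
  unfold pauliFamily
  split_ifs
  exacts [pauliX_mul_self, pauliZ_mul_self, one_mul 1]

theorem pauliFamily_of_notMem {n : ℕ} (G : SimpleGraph (Fin n)) [DecidableRel G.Adj]
    {i : Fin n} {e : G.edgeFinset} (h : i ∉ (e : Sym2 (Fin n))) : pauliFamily G i e = 1 := by
  obtain ⟨e, he⟩ := e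
  induction e with | _ a b
  simp only [Sym2.mem_iff, not_or] at h
  have h₁ : i ≠ a ⊓ b := by rcases min_choice a b with h' | h' <;> simp [h', h]
  have h₂ : i ≠ a ⊔ b := by rcases max_choice a b with h' | h' <;> simp [h', h]
  simp [pauliFamily, h₁, h₂]

theorem commute_pauliFamily {n : ℕ} (G : SimpleGraph (Fin n)) [DecidableRel G.Adj]
    {i j : Fin n} (e : G.edgeFinset) (h : i ≠ j → (e : Sym2 (Fin n)) ≠ s(i, j)) :
    Commute (pauliFamily G i e) (pauliFamily G j e) := by
  by_cases hij : i = j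
  · rw [hij]
  by_cases hi : i ∈ (e : Sym2 (Fin n))
  · have hj : j ∉ (e : Sym2 (Fin n)) := fun hj =>
      h hij ((Sym2.mem_and_mem_iff hij).mp ⟨hi, hj⟩)
    rw [pauliFamily_of_notMem G hj]
    exact Commute.one_right _
  · rw [pauliFamily_of_notMem G hi]
    exact Commute.one_left _

theorem pauliFamily_anticommute {n : ℕ} (G : SimpleGraph (Fin n)) [DecidableRel G.Adj]
    {i j : Fin n} (hij : i ≠ j) (e : G.edgeFinset) (he : (e : Sym2 (Fin n)) = s(i, j)) :
    pauliFamily G i e * pauliFamily G j e = -(pauliFamily G j e * pauliFamily G i e) := by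
  rcases lt_or_gt_of_ne hij with h | h
  · simp [pauliFamily, he, h.le, hij.symm, pauliX_mul_pauliZ]
  · simp [pauliFamily, he, h.le, hij, pauliX_mul_pauliZ]

theorem gMat_mul_self {n : ℕ} (G : SimpleGraph (Fin n)) [DecidableRel G.Adj] (i : Fin n) :
    gMat G i * gMat G i = 1 := by
  simp only [gMat, tensorProd_mul, pauliFamily_mul_self, tensorProd_one]

theorem gMat_anticommute {n : ℕ} (G : SimpleGraph (Fin n)) [DecidableRel G.Adj]
    {i j : Fin n} (h : G.Adj i j) : gMat G i * gMat G j = -(gMat G j * gMat G i) := by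
  have he : s(i, j) ∈ G.edgeFinset := by simpa using h
  have key : (fun e => pauliFamily G i e * pauliFamily G j e) = fun e =>
      (if e = ⟨s(i, j), he⟩ then (-1 : ℂ) else 1) •
        (pauliFamily G j e * pauliFamily G i e) := by
    funext e
    split_ifs with h'
    · rw [pauliFamily_anticommute G h.ne e (congrArg Subtype.val h'), neg_one_smul]
    · rw [one_smul]
      exact commute_pauliFamily G e fun _ h'' => h' (Subtype.ext h'')
  rw [gMat, gMat, tensorProd_mul, key, tensorProd_smul, tensorProd_mul]
  simp

/-- The matrices `g_i` and `g_j` commute if and only if `i` and `j` are not adjacent. -/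
theorem gMat_commute_iff_not_adj {n : ℕ} (G : SimpleGraph (Fin n)) [DecidableRel G.Adj]
    (i j : Fin n) :
    Commute (gMat G i) (gMat G j) ↔ ¬ G.Adj i j := by
  constructor
  · intro hc h
    have hzero : gMat G i * gMat G j = 0 := by
      have := gMat_anticommute G h
      rw [← hc.eq] at this
      ext f g
      exact self_eq_neg.mp (congrFun (congrFun this f) g)
    have hone : gMat G i * gMat G j * (gMat G j * gMat G i) = 1 := by
      rw [mul_assoc, ← mul_assoc (gMat G j), gMat_mul_self, one_mul, gMat_mul_self]
    rw [hzero, zero_mul] at hone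
    exact zero_ne_one hone
  · intro h
    rw [Commute, SemiconjBy, gMat, gMat, tensorProd_mul, tensorProd_mul]
    congr 1
    funext e
    refine commute_pauliFamily G e fun _ he => h ?_
    have := e.2
    rwa [he, SimpleGraph.mem_edgeFinset, SimpleGraph.mem_edgeSet] at this
end

section
/- Let G be a group, u : ℕ → G, and w : ℕ → ℝ. Then for all natural numbers i ≤ j, the optimum W(i, j) satisfies the recursion W(i, j) = max(W(i+1, j), M), where M is the maximum of w i + W(i+1, k-1) + W(k+1, j) over all k with i+1 ≤ k ≤ j and u k = (u i)⁻¹ (with the convention that W on an empty range [a, b] with b < a is 0, and that the maximum M over an empty set of such k is taken so that W(i, j) = W(i+1, j) in that case). -/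
/-- A non-crossing conjugation matching on the range `[i, j]`: a finite set of conjugation
pairs `(a, b)` with `i ≤ a < b ≤ j` and `u b = (u a)⁻¹`, pairwise distinct endpoints, and no
two distinct pairs interlacing. -/
def IsNCMatching {G : Type*} [Group G] (u : ℕ → G) (i j : ℕ) (M : Finset (ℕ × ℕ)) : Prop :=
  (∀ p ∈ M, i ≤ p.1 ∧ p.1 < p.2 ∧ p.2 ≤ j ∧ u p.2 = (u p.1)⁻¹) ∧
  (∀ p ∈ M, ∀ q ∈ M, p ≠ q → p.1 ≠ q.1 ∧ p.1 ≠ q.2 ∧ p.2 ≠ q.1 ∧ p.2 ≠ q.2) ∧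
  (∀ p ∈ M, ∀ q ∈ M, p ≠ q → ¬ Interlace p q)

/-- `W u w i j` is the maximum weight of a non-crossing conjugation matching on `[i, j]`
(the supremum is attained: there are finitely many such matchings, and the empty matching,
of weight `0`, is one of them; in particular `W u w i j = 0` whenever `j < i`). -/
noncomputable def W {G : Type*} [Group G] (u : ℕ → G) (w : ℕ → ℝ) (i j : ℕ) : ℝ :=
  sSup {x : ℝ | ∃ M : Finset (ℕ × ℕ), IsNCMatching u i j M ∧ x = ∑ p ∈ M, w p.1}

namespace IsNCMatching

variable {G : Type*} [Group G] {u : ℕ → G} {i j k : ℕ} {M M₁ M₂ : Finset (ℕ × ℕ)}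

theorem empty (u : ℕ → G) (i j : ℕ) : IsNCMatching u i j ∅ := by
  simp [IsNCMatching]

theorem finite_setOf (u : ℕ → G) (i j : ℕ) : {M | IsNCMatching u i j M}.Finite := by
  refine (Finset.Icc i j ×ˢ Finset.Icc i j).powerset.finite_toSet.subset fun M hM => ?_
  simp only [Finset.coe_powerset, Set.mem_preimage, Set.mem_powerset_iff, Finset.coe_subset]
  intro p hp
  obtain ⟨h₁, h₂, h₃, -⟩ := hM.1 p hp
  simp only [Finset.mem_product, Finset.mem_Icc]
  omega

theorem finite_weights (u : ℕ → G) (w : ℕ → ℝ) (i j : ℕ) :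
    {x : ℝ | ∃ M : Finset (ℕ × ℕ), IsNCMatching u i j M ∧ x = ∑ p ∈ M, w p.1}.Finite := by
  refine ((finite_setOf u i j).image fun M => ∑ p ∈ M, w p.1).subset ?_
  rintro x ⟨M, hM, rfl⟩
  exact ⟨M, hM, rfl⟩

theorem sum_le_W (hM : IsNCMatching u i j M) (w : ℕ → ℝ) : ∑ p ∈ M, w p.1 ≤ W u w i j :=
  le_csSup (finite_weights u w i j).bddAbove ⟨M, hM, rfl⟩

theorem exists_sum_eq_W (u : ℕ → G) (w : ℕ → ℝ) (i j : ℕ) :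
    ∃ M, IsNCMatching u i j M ∧ W u w i j = ∑ p ∈ M, w p.1 :=
  Set.Nonempty.csSup_mem (s := {x : ℝ | ∃ M, IsNCMatching u i j M ∧ x = ∑ p ∈ M, w p.1})
    ⟨_, ∅, empty u i j, rfl⟩ (finite_weights u w i j)

theorem mono_left {i' : ℕ} (hM : IsNCMatching u i' j M) (h : i ≤ i') : IsNCMatching u i j M :=
  ⟨fun p hp => ⟨h.trans (hM.1 p hp).1, (hM.1 p hp).2⟩, hM.2⟩

theorem of_subset {i' j' : ℕ} (hM : IsNCMatching u i j M) (hsub : M₁ ⊆ M)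
    (hl : ∀ p ∈ M₁, i' ≤ p.1) (hr : ∀ p ∈ M₁, p.2 ≤ j') : IsNCMatching u i' j' M₁ :=
  ⟨fun p hp => ⟨hl p hp, (hM.1 p (hsub hp)).2.1, hr p hp, (hM.1 p (hsub hp)).2.2.2⟩,
    fun p hp q hq => hM.2.1 p (hsub hp) q (hsub hq),
    fun p hp q hq => hM.2.2 p (hsub hp) q (hsub hq)⟩

theorem insert_union (h₁ : IsNCMatching u (i + 1) (k - 1) M₁) (h₂ : IsNCMatching u (k + 1) j M₂)
    (hik : i < k) (hkj : k ≤ j) (hu : u k = (u i)⁻¹) :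
    IsNCMatching u i j (insert (i, k) (M₁ ∪ M₂)) := by
  refine ⟨?_, ?_, ?_⟩
  · intro p hp
    simp only [Finset.mem_insert, Finset.mem_union] at hp
    rcases hp with rfl | hp | hp
    · exact ⟨le_rfl, hik, hkj, hu⟩
    · obtain ⟨a, b, c, d⟩ := h₁.1 p hp
      exact ⟨by omega, b, by omega, d⟩
    · obtain ⟨a, b, c, d⟩ := h₂.1 p hp
      exact ⟨by omega, b, c, d⟩
  · intro p hp q hq hpq
    simp only [Finset.mem_insert, Finset.mem_union] at hp hq
    have := h₁.1 p
    have := h₁.1 q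
    have := h₂.1 p
    have := h₂.1 q
    have := h₁.2.1 p
    have := h₂.2.1 p
    grind
  · intro p hp q hq hpq
    simp only [Finset.mem_insert, Finset.mem_union] at hp hq
    have := h₁.1 p
    have := h₁.1 q
    have := h₂.1 p
    have := h₂.1 q
    have := h₁.2.2 p
    have := h₂.2.2 p
    unfold Interlace at *
    grind

theorem sum_insert_union (h₁ : IsNCMatching u (i + 1) (k - 1) M₁)
    (h₂ : IsNCMatching u (k + 1) j M₂) (w : ℕ → ℝ) :
    ∑ p ∈ insert (i, k) (M₁ ∪ M₂), w p.1 = w i + ∑ p ∈ M₁, w p.1 + ∑ p ∈ M₂, w p.1 := by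
  have hdisj : Disjoint M₁ M₂ := Finset.disjoint_left.2 fun p hp hp' => by
    have := h₁.1 p hp
    have := h₂.1 p hp'
    omega
  have hnot : (i, k) ∉ M₁ ∪ M₂ := by
    intro h
    rcases Finset.mem_union.1 h with h | h
    · have := (h₁.1 _ h).1
      simp at this
    · obtain ⟨a, b, -⟩ := h₂.1 _ h
      simp only at a b
      omega
  rw [Finset.sum_insert hnot, Finset.sum_union hdisj, add_assoc]

/-- A matching on `[i, j]` containing `(i, k)` splits into `(i, k)`, the pairs nested inside it
and the pairs to its right. -/
theorem exists_eq_insert_union (hM : IsNCMatching u i j M) (hk : (i, k) ∈ M) :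
    ∃ M₁ M₂, IsNCMatching u (i + 1) (k - 1) M₁ ∧ IsNCMatching u (k + 1) j M₂ ∧
      M = insert (i, k) (M₁ ∪ M₂) := by
  have hsplit : ∀ p ∈ M, p = (i, k) ∨ (i < p.1 ∧ p.2 < k) ∨ k < p.1 := by
    intro p hp
    by_cases hpk : p = (i, k)
    · exact Or.inl hpk
    · have hd := hM.2.1 p hp _ hk hpk
      have hn := hM.2.2 p hp _ hk hpk
      have hb := hM.1 p hp
      simp only [Interlace] at hd hn
      omega
  refine ⟨M.filter fun p => i < p.1 ∧ p.2 < k, M.filter fun p => k < p.1,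
    hM.of_subset (Finset.filter_subset _ _) ?_ ?_,
    hM.of_subset (Finset.filter_subset _ _) ?_ ?_, ?_⟩
  · grind
  · grind
  · grind
  · exact fun p hp => (hM.1 p (Finset.mem_filter.1 hp).1).2.2.1
  · ext p
    have := hsplit p
    grind

end IsNCMatching

section Recursion

variable {G : Type*} [Group G] (u : ℕ → G) (w : ℕ → ℝ) (i j : ℕ)

theorem W_succ_le : W u w (i + 1) j ≤ W u w i j := by
  obtain ⟨M, hM, h⟩ := IsNCMatching.exists_sum_eq_W u w (i + 1) j
  exact h ▸ (hM.mono_left i.le_succ).sum_le_W w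

theorem add_W_add_W_le {k : ℕ} (hik : i < k) (hkj : k ≤ j) (hu : u k = (u i)⁻¹) :
    w i + W u w (i + 1) (k - 1) + W u w (k + 1) j ≤ W u w i j := by
  obtain ⟨M₁, h₁, e₁⟩ := IsNCMatching.exists_sum_eq_W u w (i + 1) (k - 1)
  obtain ⟨M₂, h₂, e₂⟩ := IsNCMatching.exists_sum_eq_W u w (k + 1) j
  rw [e₁, e₂, ← h₁.sum_insert_union h₂]
  exact (h₁.insert_union h₂ hik hkj hu).sum_le_W w

theorem W_le_succ_or_exists : W u w i j ≤ W u w (i + 1) j ∨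
    ∃ k, i < k ∧ k ≤ j ∧ u k = (u i)⁻¹ ∧
      W u w i j ≤ w i + W u w (i + 1) (k - 1) + W u w (k + 1) j := by
  obtain ⟨M, hM, e⟩ := IsNCMatching.exists_sum_eq_W u w i j
  by_cases h : ∃ k, (i, k) ∈ M
  · obtain ⟨k, hk⟩ := h
    obtain ⟨-, hik, hkj, hu⟩ := hM.1 _ hk
    obtain ⟨M₁, M₂, h₁, h₂, rfl⟩ := hM.exists_eq_insert_union hk
    refine Or.inr ⟨k, hik, hkj, hu, ?_⟩
    rw [e, h₁.sum_insert_union h₂]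
    gcongr
    · exact h₁.sum_le_W w
    · exact h₂.sum_le_W w
  · refine Or.inl (e ▸ IsNCMatching.sum_le_W (hM.of_subset subset_rfl ?_ ?_) w)
    · rintro ⟨a, b⟩ hp
      exact lt_of_le_of_ne (hM.1 _ hp).1 fun hia : i = a => h ⟨b, hia ▸ hp⟩
    · exact fun p hp => (hM.1 p hp).2.2.1

end Recursion

/-- The dynamic-programming recursion for the maximum weight of non-crossing conjugation
matchings: `W i j` is the maximum of `W (i+1) j` (no pair starting at `i`) and of
`w i + W (i+1) (k-1) + W (k+1) j` over all `k ∈ [i+1, j]` with `u k = (u i)⁻¹`; if no such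
`k` exists, `W i j = W (i+1) j`. -/
theorem W_recursion {G : Type*} [Group G] [DecidableEq G] (u : ℕ → G) (w : ℕ → ℝ)
    (i j : ℕ) (hij : i ≤ j) :
    W u w i j =
      if h : ((Finset.Icc (i + 1) j).filter fun k => u k = (u i)⁻¹).Nonempty then
        max (W u w (i + 1) j)
          (((Finset.Icc (i + 1) j).filter fun k => u k = (u i)⁻¹).sup' h
            fun k => w i + W u w (i + 1) (k - 1) + W u w (k + 1) j)
      else W u w (i + 1) j := by
  split_ifs with h
  · apply le_antisymm
    · rcases W_le_succ_or_exists u w i j with hle | ⟨k, hik, hkj, hu, hle⟩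
      · exact le_max_of_le_left hle
      · refine le_max_of_le_right (hle.trans ?_)
        exact Finset.le_sup' (fun k => w i + W u w (i + 1) (k - 1) + W u w (k + 1) j)
          (Finset.mem_filter.2 ⟨Finset.mem_Icc.2 ⟨hik, hkj⟩, hu⟩)
    · refine max_le (W_succ_le u w i j) (Finset.sup'_le _ _ fun k hk => ?_)
      obtain ⟨hk, hu⟩ := Finset.mem_filter.1 hk
      obtain ⟨hik, hkj⟩ := Finset.mem_Icc.1 hk
      exact add_W_add_W_le u w i j hik hkj hu
  · refine le_antisymm ?_ (W_succ_le u w i j)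
    rcases W_le_succ_or_exists u w i j with hle | ⟨k, hik, hkj, hu, -⟩
    · exact hle
    · exact absurd ⟨k, Finset.mem_filter.2 ⟨Finset.mem_Icc.2 ⟨hik, hkj⟩, hu⟩⟩ h
end
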